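/- arXiv:2102.07180 — 2 statements merged into one kernel-verified Lean document; each statement's English description precedes it below -/
import Mathlib

section
/- Let n ≥ 4 be an integer, α ∈ ℝ, I ⊆ ℝ an open interval, and F : ℝ × I → (0,∞) a smooth function satisfying the rotationally symmetric Ricci flow profile equation F_t = F_zz − (n−2)·F^{-1}·(1 − F_z²) − (n−1)·F_z·∫₀^z (F_zz(z',t)/F(z',t)) dz', where subscripts denote partial derivatives. Define H(z,t) := (1/2)·F(z,t)² + (n−2)·t, K(z,t) := F_z(z,t)⁴, and Q := H_zz − α·K. Then for all (z,t) ∈ ℝ × I, Q_t − Q_zz = ((n−5)·F_z/F − (n−1)·∫₀^z (F_zz(z',t)/F(z',t)) dz')·Q_z − (4(n−4) + 8α·F_z²)·F_z²·F_zz/F − (4 − 12α·F_z²)·F_zz² − 4α(n−2)·(1 − F_z²)·F_z⁴/F², where all functions on the right-hand side are evaluated at (z,t). -/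
open Filter Set intervalIntegral
open scoped ContDiff

/-- Partial derivative in the first variable. -/
noncomputable def d1 (F : ℝ → ℝ → ℝ) : ℝ → ℝ → ℝ := fun x y => deriv (fun x' => F x' y) x

/-- Partial derivative in the second variable. -/
noncomputable def d2 (F : ℝ → ℝ → ℝ) : ℝ → ℝ → ℝ := fun x y => deriv (fun y' => F x y') y

/-- The first partial derivative of a smooth function is the value of its total derivative. -/
theorem hasDerivAt_fst_of_contDiffOn {I : Set ℝ} (hI : IsOpen I) {G : ℝ → ℝ → ℝ}
    (hG : ContDiffOn ℝ ∞ (fun p : ℝ × ℝ => G p.1 p.2) (Set.univ ×ˢ I)) (z : ℝ) {t : ℝ}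
    (ht : t ∈ I) :
    HasDerivAt (fun x => G x t) (fderiv ℝ (fun p : ℝ × ℝ => G p.1 p.2) (z, t) (1, 0)) z := by
  have hd : DifferentiableAt ℝ (fun p : ℝ × ℝ => G p.1 p.2) (z, t) :=
    (hG.contDiffAt ((isOpen_univ.prod hI).mem_nhds ⟨trivial, ht⟩)).differentiableAt (by simp)
  exact hd.hasFDerivAt.comp_hasDerivAt z ((hasDerivAt_id z).prodMk (hasDerivAt_const z t))

theorem hasDerivAt_snd_of_contDiffOn {I : Set ℝ} (hI : IsOpen I) {G : ℝ → ℝ → ℝ}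
    (hG : ContDiffOn ℝ ∞ (fun p : ℝ × ℝ => G p.1 p.2) (Set.univ ×ˢ I)) (z : ℝ) {t : ℝ}
    (ht : t ∈ I) :
    HasDerivAt (fun y => G z y) (fderiv ℝ (fun p : ℝ × ℝ => G p.1 p.2) (z, t) (0, 1)) t := by
  have hd : DifferentiableAt ℝ (fun p : ℝ × ℝ => G p.1 p.2) (z, t) :=
    (hG.contDiffAt ((isOpen_univ.prod hI).mem_nhds ⟨trivial, ht⟩)).differentiableAt (by simp)
  exact hd.hasFDerivAt.comp_hasDerivAt t ((hasDerivAt_const t z).prodMk (hasDerivAt_id t))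

theorem hasDerivAt_d1 {I : Set ℝ} (hI : IsOpen I) {G : ℝ → ℝ → ℝ}
    (hG : ContDiffOn ℝ ∞ (fun p : ℝ × ℝ => G p.1 p.2) (Set.univ ×ˢ I)) (z : ℝ) {t : ℝ}
    (ht : t ∈ I) : HasDerivAt (fun x => G x t) (d1 G z t) z :=
  (hasDerivAt_fst_of_contDiffOn hI hG z ht).differentiableAt.hasDerivAt

theorem hasDerivAt_d2 {I : Set ℝ} (hI : IsOpen I) {G : ℝ → ℝ → ℝ}
    (hG : ContDiffOn ℝ ∞ (fun p : ℝ × ℝ => G p.1 p.2) (Set.univ ×ˢ I)) (z : ℝ) {t : ℝ}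
    (ht : t ∈ I) : HasDerivAt (fun y => G z y) (d2 G z t) t :=
  (hasDerivAt_snd_of_contDiffOn hI hG z ht).differentiableAt.hasDerivAt

theorem contDiffOn_fderiv_apply {I : Set ℝ} (hI : IsOpen I) {g : ℝ × ℝ → ℝ}
    (hg : ContDiffOn ℝ ∞ g (Set.univ ×ˢ I)) (v : ℝ × ℝ) :
    ContDiffOn ℝ ∞ (fun p => fderiv ℝ g p v) (Set.univ ×ˢ I) :=
  (hg.fderiv_of_isOpen (m := ∞) (isOpen_univ.prod hI) (by simp)).clm_apply contDiffOn_const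

theorem contDiffOn_d1 {I : Set ℝ} (hI : IsOpen I) {G : ℝ → ℝ → ℝ}
    (hG : ContDiffOn ℝ ∞ (fun p : ℝ × ℝ => G p.1 p.2) (Set.univ ×ˢ I)) :
    ContDiffOn ℝ ∞ (fun p : ℝ × ℝ => d1 G p.1 p.2) (Set.univ ×ˢ I) :=
  (contDiffOn_fderiv_apply hI hG (1, 0)).congr fun p hp =>
    (hasDerivAt_fst_of_contDiffOn hI hG p.1 hp.2).deriv

/-- Mixed partial derivatives of a smooth function commute. -/
theorem d2_d1_comm {I : Set ℝ} (hI : IsOpen I) {G : ℝ → ℝ → ℝ}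
    (hG : ContDiffOn ℝ ∞ (fun p : ℝ × ℝ => G p.1 p.2) (Set.univ ×ˢ I)) (z : ℝ) {t : ℝ}
    (ht : t ∈ I) : d2 (d1 G) z t = d1 (d2 G) z t := by
  set g : ℝ × ℝ → ℝ := fun p => G p.1 p.2
  have hat : ContDiffAt ℝ ∞ g (z, t) :=
    hG.contDiffAt ((isOpen_univ.prod hI).mem_nhds ⟨trivial, ht⟩)
  have hdd : DifferentiableAt ℝ (fderiv ℝ g) (z, t) :=
    (hat.fderiv_right (m := ∞) (by simp)).differentiableAt (by simp)
  have hsymm : IsSymmSndFDerivAt ℝ g (z, t) :=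
    hat.isSymmSndFDerivAt (by
      simpa using WithTop.coe_le_coe.2 (le_top (a := (2 : ℕ∞))))
  have happ (v w : ℝ × ℝ) :
      fderiv ℝ (fun p => fderiv ℝ g p v) (z, t) w = fderiv ℝ (fderiv ℝ g) (z, t) w v := by
    rw [(hdd.hasFDerivAt.clm_apply (hasFDerivAt_const v (z, t))).fderiv]
    simp
  have h21 : d2 (d1 G) z t = fderiv ℝ (fun p => fderiv ℝ g p (1, 0)) (z, t) (0, 1) := by
    refine HasDerivAt.deriv ?_
    refine (hasDerivAt_snd_of_contDiffOn hI (G := fun x y => fderiv ℝ g (x, y) (1, 0))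
      (contDiffOn_fderiv_apply hI hG (1, 0)) z ht).congr_of_eventuallyEq ?_
    filter_upwards [hI.mem_nhds ht] with y hy
    exact (hasDerivAt_fst_of_contDiffOn hI hG z hy).deriv
  have h12 : d1 (d2 G) z t = fderiv ℝ (fun p => fderiv ℝ g p (0, 1)) (z, t) (1, 0) := by
    refine HasDerivAt.deriv ?_
    refine (hasDerivAt_fst_of_contDiffOn hI (G := fun x y => fderiv ℝ g (x, y) (0, 1))
      (contDiffOn_fderiv_apply hI hG (0, 1)) z ht).congr_of_eventuallyEq ?_
    exact .of_forall fun x => (hasDerivAt_snd_of_contDiffOn hI hG x ht).deriv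
  rw [h21, h12, happ, happ]
  exact hsymm _ _

/-- evolution equation for `Q = H_zz - α K`. -/
theorem stmt_7 (n : ℕ) (hn : 4 ≤ n) (α : ℝ)
    (I : Set ℝ) (hIopen : IsOpen I) (hIconn : I.OrdConnected)
    (F : ℝ → ℝ → ℝ)
    (hFsmooth : ContDiffOn ℝ ∞ (fun p : ℝ × ℝ => F p.1 p.2) (Set.univ ×ˢ I))
    (hFpos : ∀ z : ℝ, ∀ t ∈ I, 0 < F z t)
    (hF : ∀ z : ℝ, ∀ t ∈ I, d2 F z t = d1 (d1 F) z t
        - ((n:ℝ) - 2) * (F z t)⁻¹ * (1 - (d1 F z t) ^ 2)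
        - ((n:ℝ) - 1) * d1 F z t * ∫ z' in (0:ℝ)..z, d1 (d1 F) z' t / F z' t)
    (H : ℝ → ℝ → ℝ)
    (hH : ∀ z t : ℝ, H z t = (1/2) * (F z t) ^ 2 + ((n:ℝ) - 2) * t)
    (K : ℝ → ℝ → ℝ)
    (hK : ∀ z t : ℝ, K z t = (d1 F z t) ^ 4)
    (Q : ℝ → ℝ → ℝ)
    (hQ : ∀ z t : ℝ, Q z t = d1 (d1 H) z t - α * K z t) :
    ∀ z : ℝ, ∀ t ∈ I,
      d2 Q z t - d1 (d1 Q) z t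
        = (((n:ℝ) - 5) * d1 F z t / F z t
            - ((n:ℝ) - 1) * ∫ z' in (0:ℝ)..z, d1 (d1 F) z' t / F z' t) * d1 Q z t
          - (4 * ((n:ℝ) - 4) + 8 * α * (d1 F z t) ^ 2) * (d1 F z t) ^ 2 * d1 (d1 F) z t / F z t
          - (4 - 12 * α * (d1 F z t) ^ 2) * (d1 (d1 F) z t) ^ 2
          - 4 * α * ((n:ℝ) - 2) * (1 - (d1 F z t) ^ 2) * (d1 F z t) ^ 4 / (F z t) ^ 2 := by
  have hS1 := contDiffOn_d1 hIopen hFsmooth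
  have hS2 := contDiffOn_d1 hIopen hS1
  have hS3 := contDiffOn_d1 hIopen hS2
  have hu (x : ℝ) {t : ℝ} (ht : t ∈ I) := hasDerivAt_d1 hIopen hFsmooth x ht
  have hp (x : ℝ) {t : ℝ} (ht : t ∈ I) := hasDerivAt_d1 hIopen hS1 x ht
  have hq (x : ℝ) {t : ℝ} (ht : t ∈ I) := hasDerivAt_d1 hIopen hS2 x ht
  have hr (x : ℝ) {t : ℝ} (ht : t ∈ I) := hasDerivAt_d1 hIopen hS3 x ht
  have hQ0 (x : ℝ) {t : ℝ} (ht : t ∈ I) :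
      Q x t = (d1 F x t) ^ 2 + F x t * d1 (d1 F) x t - α * (d1 F x t) ^ 4 := by
    have hH1 (x : ℝ) : d1 H x t = F x t * d1 F x t := by
      refine HasDerivAt.deriv ?_
      simp only [hH]
      exact ((((hu x ht).pow 2).const_mul (1 / 2)).add_const _).congr_deriv (by norm_num; ring)
    have hH2 : d1 (d1 H) x t = (d1 F x t) ^ 2 + F x t * d1 (d1 F) x t := by
      refine HasDerivAt.deriv ?_
      simp only [hH1]
      exact ((hu x ht).mul (hp x ht)).congr_deriv (by ring)
    rw [hQ, hK, hH2]
  intro z t ht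
  have hne (x : ℝ) : F x t ≠ 0 := (hFpos x t ht).ne'
  have hQ1 (x : ℝ) : d1 Q x t = 3 * d1 F x t * d1 (d1 F) x t + F x t * d1 (d1 (d1 F)) x t
      - 4 * α * (d1 F x t) ^ 3 * d1 (d1 F) x t := by
    refine HasDerivAt.deriv ?_
    simp only [fun x => hQ0 x ht]
    exact ((((hp x ht).pow 2).add ((hu x ht).mul (hq x ht))).sub
      (((hp x ht).pow 4).const_mul α)).congr_deriv (by norm_num; ring)
  have hQ2 : d1 (d1 Q) z t = 3 * (d1 (d1 F) z t) ^ 2 + 4 * d1 F z t * d1 (d1 (d1 F)) z t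
      + F z t * d1 (d1 (d1 (d1 F))) z t
      - 12 * α * (d1 F z t) ^ 2 * (d1 (d1 F) z t) ^ 2
      - 4 * α * (d1 F z t) ^ 3 * d1 (d1 (d1 F)) z t := by
    refine HasDerivAt.deriv ?_
    simp only [hQ1]
    exact (((((hp z ht).const_mul 3).mul (hq z ht)).add ((hu z ht).mul (hr z ht))).sub
      ((((hp z ht).pow 3).const_mul (4 * α)).mul (hq z ht))).congr_deriv (by norm_num; ring)
  have hQt : d2 Q z t = 2 * d1 F z t * d2 (d1 F) z t + d2 F z t * d1 (d1 F) z t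
      + F z t * d2 (d1 (d1 F)) z t - 4 * α * (d1 F z t) ^ 3 * d2 (d1 F) z t := by
    refine HasDerivAt.deriv ?_
    have hut := hasDerivAt_d2 hIopen hFsmooth z ht
    have hpt := hasDerivAt_d2 hIopen hS1 z ht
    have hqt := hasDerivAt_d2 hIopen hS2 z ht
    refine HasDerivAt.congr_of_eventuallyEq (((hpt.pow 2).add (hut.mul hqt)).sub
      ((hpt.pow 4).const_mul α) |>.congr_deriv (by norm_num; ring)) ?_
    filter_upwards [hIopen.mem_nhds ht] with y hy
    exact hQ0 z hy
  set J : ℝ → ℝ := fun x => ∫ z' in (0:ℝ)..x, d1 (d1 F) z' t / F z' t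
  have hJ (x : ℝ) : HasDerivAt J (d1 (d1 F) x t / F x t) x := by
    have hcont : Continuous fun x => d1 (d1 F) x t / F x t :=
      continuous_iff_continuousAt.2 fun x =>
        (hq x ht).continuousAt.div (hu x ht).continuousAt (hne x)
    exact integral_hasDerivAt_right (hcont.intervalIntegrable _ _)
      hcont.stronglyMeasurable.stronglyMeasurableAtFilter hcont.continuousAt
  have hF0 (x : ℝ) : d2 F x t = d1 (d1 F) x t
      - ((n:ℝ) - 2) * (F x t)⁻¹ * (1 - (d1 F x t) ^ 2) - ((n:ℝ) - 1) * d1 F x t * J x :=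
    hF x t ht
  have hpt (x : ℝ) : d2 (d1 F) x t = d1 (d1 (d1 F)) x t
      + ((n:ℝ) - 2) * (2 * d1 F x t * d1 (d1 F) x t * (F x t)⁻¹
        + (1 - (d1 F x t) ^ 2) * d1 F x t * ((F x t)⁻¹) ^ 2)
      - ((n:ℝ) - 1) * (d1 (d1 F) x t * J x + d1 F x t * d1 (d1 F) x t * (F x t)⁻¹) := by
    rw [d2_d1_comm hIopen hFsmooth x ht]
    refine HasDerivAt.deriv ?_
    simp only [hF0]
    have hx := hne x
    exact (((hq x ht).sub ((((hu x ht).inv hx).const_mul ((n:ℝ) - 2)).mul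
      (((hp x ht).pow 2).const_sub 1))).sub
      (((hp x ht).const_mul ((n:ℝ) - 1)).mul (hJ x))).congr_deriv (by norm_num; field_simp; ring)
  have hqt : d2 (d1 (d1 F)) z t = d1 (d1 (d1 (d1 F))) z t
      + ((n:ℝ) - 2) * (2 * ((d1 (d1 F) z t) ^ 2 + d1 F z t * d1 (d1 (d1 F)) z t) * (F z t)⁻¹
        + (1 - 5 * (d1 F z t) ^ 2) * d1 (d1 F) z t * ((F z t)⁻¹) ^ 2
        - 2 * (1 - (d1 F z t) ^ 2) * (d1 F z t) ^ 2 * ((F z t)⁻¹) ^ 3)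
      - ((n:ℝ) - 1) * (d1 (d1 (d1 F)) z t * J z
        + (2 * (d1 (d1 F) z t) ^ 2 + d1 F z t * d1 (d1 (d1 F)) z t) * (F z t)⁻¹
        - (d1 F z t) ^ 2 * d1 (d1 F) z t * ((F z t)⁻¹) ^ 2) := by
    rw [d2_d1_comm hIopen hS1 z ht]
    refine HasDerivAt.deriv ?_
    simp only [hpt]
    have hz := hne z
    have hi := (hu z ht).inv hz
    exact (((hr z ht).add ((((((hp z ht).const_mul 2).mul (hq z ht)).mul hi).add
      (((((hp z ht).pow 2).const_sub 1).mul (hp z ht)).mul (hi.pow 2))).const_mul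
        ((n:ℝ) - 2))).sub
      ((((hq z ht).mul (hJ z)).add (((hp z ht).mul (hq z ht)).mul hi)).const_mul
        ((n:ℝ) - 1))).congr_deriv (by norm_num; field_simp; ring)
  change _ = (((n:ℝ) - 5) * d1 F z t / F z t - ((n:ℝ) - 1) * J z) * d1 Q z t - _ - _ - _
  rw [hQt, hQ2, hQ1, hqt, hpt, hF0]
  have hz := hne z
  field_simp
  ring
end

section
/- Let n ≥ 4 be an integer, I ⊆ ℝ an open interval, and F : ℝ × I → (0,∞) a smooth function satisfying the rotationally symmetric Ricci flow profile equation F_t = F_zz − (n−2)·F^{-1}·(1 − F_z²) − (n−1)·F_z·∫₀^z (F_zz(z',t)/F(z',t)) dz', where subscripts denote partial derivatives. Let D ⊆ ℝ × I be an open subset on which F_z ≠ 0, and let U be a smooth positive function defined on an open subset of (0,∞) × I containing {(F(z,t), t) : (z,t) ∈ D}, satisfying U(F(z,t), t) = F_z(z,t)² for all (z,t) ∈ D. Then at every point (r,t) = (F(z,t), t) with (z,t) ∈ D, U satisfies U^{-1}·U_t = U_rr − (1/2)·U^{-1}·(U_r)² + (n−2)·r^{-2}·(U^{-1} − 1)·(r·U_r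 + 2U) + (n−3)·r^{-1}·U_r. -/
open Filter Set intervalIntegral
open scoped ContDiff

section PartialDerivatives

variable {f : ℝ → ℝ → ℝ} {S : Set (ℝ × ℝ)}

theorem hasFDerivAt_of_contDiffOn_isOpen (hS : IsOpen S)
    (hf : ContDiffOn ℝ ∞ (fun p : ℝ × ℝ => f p.1 p.2) S) {x y : ℝ} (hp : (x, y) ∈ S) :
    HasFDerivAt (fun p : ℝ × ℝ => f p.1 p.2)
      (fderiv ℝ (fun p : ℝ × ℝ => f p.1 p.2) (x, y)) (x, y) :=
  ((hf.contDiffAt (hS.mem_nhds hp)).differentiableAt (by simp)).hasFDerivAt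

theorem d1_eq_fderiv (hS : IsOpen S)
    (hf : ContDiffOn ℝ ∞ (fun p : ℝ × ℝ => f p.1 p.2) S) {x y : ℝ} (hp : (x, y) ∈ S) :
    d1 f x y = fderiv ℝ (fun p : ℝ × ℝ => f p.1 p.2) (x, y) (1, 0) :=
  ((hasFDerivAt_of_contDiffOn_isOpen hS hf hp).comp_hasDerivAt x (f := fun x' => (x', y))
    ((hasDerivAt_id x).prodMk (hasDerivAt_const x y))).deriv

theorem d2_eq_fderiv (hS : IsOpen S)
    (hf : ContDiffOn ℝ ∞ (fun p : ℝ × ℝ => f p.1 p.2) S) {x y : ℝ} (hp : (x, y) ∈ S) :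
    d2 f x y = fderiv ℝ (fun p : ℝ × ℝ => f p.1 p.2) (x, y) (0, 1) :=
  ((hasFDerivAt_of_contDiffOn_isOpen hS hf hp).comp_hasDerivAt y (f := fun y' => (x, y'))
    ((hasDerivAt_const y x).prodMk (hasDerivAt_id y))).deriv

theorem contDiffOn_d1_s18 (hS : IsOpen S)
    (hf : ContDiffOn ℝ ∞ (fun p : ℝ × ℝ => f p.1 p.2) S) :
    ContDiffOn ℝ ∞ (fun p : ℝ × ℝ => d1 f p.1 p.2) S :=
  ((hf.fderiv_of_isOpen hS (m := ∞) (by simp)).clm_apply contDiffOn_const).congr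
    fun _ hp => d1_eq_fderiv hS hf hp

theorem contDiffOn_d2 (hS : IsOpen S)
    (hf : ContDiffOn ℝ ∞ (fun p : ℝ × ℝ => f p.1 p.2) S) :
    ContDiffOn ℝ ∞ (fun p : ℝ × ℝ => d2 f p.1 p.2) S :=
  ((hf.fderiv_of_isOpen hS (m := ∞) (by simp)).clm_apply contDiffOn_const).congr
    fun _ hp => d2_eq_fderiv hS hf hp

/-- The chain rule along a curve, in terms of the partial derivatives. -/
theorem hasDerivAt_comp_curve (hS : IsOpen S)
    (hf : ContDiffOn ℝ ∞ (fun p : ℝ × ℝ => f p.1 p.2) S) {a b : ℝ → ℝ} {a' b' s : ℝ}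
    (ha : HasDerivAt a a' s) (hb : HasDerivAt b b' s) (hp : (a s, b s) ∈ S) :
    HasDerivAt (fun u => f (a u) (b u)) (d1 f (a s) (b s) * a' + d2 f (a s) (b s) * b') s := by
  have h := (hasFDerivAt_of_contDiffOn_isOpen hS hf hp).comp_hasDerivAt s (ha.prodMk hb)
  refine h.congr_deriv ?_
  rw [d1_eq_fderiv hS hf hp, d2_eq_fderiv hS hf hp]
  have e : ((a', b') : ℝ × ℝ) = a' • ((1, 0) : ℝ × ℝ) + b' • ((0, 1) : ℝ × ℝ) := by simp
  rw [e, map_add, map_smul, map_smul, smul_eq_mul, smul_eq_mul]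
  ring

theorem hasDerivAt_d1_s18 (hS : IsOpen S)
    (hf : ContDiffOn ℝ ∞ (fun p : ℝ × ℝ => f p.1 p.2) S) {x y : ℝ} (hp : (x, y) ∈ S) :
    HasDerivAt (fun x' => f x' y) (d1 f x y) x := by
  simpa using hasDerivAt_comp_curve hS hf (hasDerivAt_id x) (hasDerivAt_const x y) hp

theorem hasDerivAt_d2_s18 (hS : IsOpen S)
    (hf : ContDiffOn ℝ ∞ (fun p : ℝ × ℝ => f p.1 p.2) S) {x y : ℝ} (hp : (x, y) ∈ S) :
    HasDerivAt (fun y' => f x y') (d2 f x y) y := by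
  simpa using hasDerivAt_comp_curve hS hf (hasDerivAt_const y x) (hasDerivAt_id y) hp

/-- Equality of mixed partial derivatives. -/
theorem d1_d2_comm (hS : IsOpen S)
    (hf : ContDiffOn ℝ ∞ (fun p : ℝ × ℝ => f p.1 p.2) S) {x y : ℝ} (hp : (x, y) ∈ S) :
    d1 (d2 f) x y = d2 (d1 f) x y := by
  have hat := hf.contDiffAt (hS.mem_nhds hp)
  have hsymm : IsSymmSndFDerivAt ℝ (fun p : ℝ × ℝ => f p.1 p.2) (x, y) :=
    hat.isSymmSndFDerivAt (by simpa using WithTop.coe_le_coe.2 (le_top : (2 : ℕ∞) ≤ ⊤))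
  have hdiff := ((hat.fderiv_right (m := 1) (by norm_cast)).differentiableAt
    (by simp)).hasFDerivAt
  rw [d1_eq_fderiv hS (contDiffOn_d2 hS hf) hp, d2_eq_fderiv hS (contDiffOn_d1_s18 hS hf) hp]
  have e1 : (fun p : ℝ × ℝ => d1 f p.1 p.2) =ᶠ[nhds (x, y)]
      fun p => fderiv ℝ (fun p : ℝ × ℝ => f p.1 p.2) p (1, 0) := by
    filter_upwards [hS.mem_nhds hp] with q hq using d1_eq_fderiv hS hf hq
  have e2 : (fun p : ℝ × ℝ => d2 f p.1 p.2) =ᶠ[nhds (x, y)]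
      fun p => fderiv ℝ (fun p : ℝ × ℝ => f p.1 p.2) p (0, 1) := by
    filter_upwards [hS.mem_nhds hp] with q hq using d2_eq_fderiv hS hf hq
  rw [e1.fderiv_eq, e2.fderiv_eq,
    (hdiff.clm_apply (hasFDerivAt_const ((1, 0) : ℝ × ℝ) (x, y))).fderiv,
    (hdiff.clm_apply (hasFDerivAt_const ((0, 1) : ℝ × ℝ) (x, y))).fderiv]
  simpa using hsymm.eq (1, 0) (0, 1)

end PartialDerivatives

/-- the local PDE satisfied by the slope-squared profile `U(r,t)`
with the radius as independent variable; proof of Proposition 7.1 of the paper. -/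
theorem stmt_18 (n : ℕ) (hn : 4 ≤ n) (I : Set ℝ) (hIopen : IsOpen I) (hIconn : I.OrdConnected)
    (F : ℝ → ℝ → ℝ)
    (hFsmooth : ContDiffOn ℝ ∞ (fun p : ℝ × ℝ => F p.1 p.2) (Set.univ ×ˢ I))
    (hFpos : ∀ z : ℝ, ∀ t ∈ I, 0 < F z t)
    (hF : ∀ z : ℝ, ∀ t ∈ I, d2 F z t = d1 (d1 F) z t
        - ((n:ℝ) - 2) * (F z t)⁻¹ * (1 - (d1 F z t) ^ 2)
        - ((n:ℝ) - 1) * d1 F z t * ∫ z' in (0:ℝ)..z, d1 (d1 F) z' t / F z' t)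
    (D : Set (ℝ × ℝ)) (hDopen : IsOpen D)
    (hDsub : D ⊆ (Set.univ : Set ℝ) ×ˢ I)
    (hFz : ∀ z t : ℝ, (z, t) ∈ D → d1 F z t ≠ 0)
    (O : Set (ℝ × ℝ)) (hOopen : IsOpen O)
    (hOsub : O ⊆ Set.Ioi (0:ℝ) ×ˢ I)
    (hOmem : ∀ z t : ℝ, (z, t) ∈ D → (F z t, t) ∈ O)
    (U : ℝ → ℝ → ℝ)
    (hUsmooth : ContDiffOn ℝ ∞ (fun p : ℝ × ℝ => U p.1 p.2) O)
    (hUpos : ∀ r t : ℝ, (r, t) ∈ O → 0 < U r t)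
    (hU : ∀ z t : ℝ, (z, t) ∈ D → U (F z t) t = (d1 F z t) ^ 2) :
    ∀ z t : ℝ, (z, t) ∈ D →
      (U (F z t) t)⁻¹ * d2 U (F z t) t
        = d1 (d1 U) (F z t) t - (1/2) * (U (F z t) t)⁻¹ * (d1 U (F z t) t) ^ 2
          + ((n:ℝ) - 2) * (F z t) ^ (-2:ℤ) * ((U (F z t) t)⁻¹ - 1)
              * (F z t * d1 U (F z t) t + 2 * U (F z t) t)
          + ((n:ℝ) - 3) * (F z t)⁻¹ * d1 U (F z t) t := by
  intro z t hzt
  have hS : IsOpen ((Set.univ : Set ℝ) ×ˢ I) := isOpen_univ.prod hIopen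
  have htI : t ∈ I := (hDsub hzt).2
  have hmem : ∀ x : ℝ, (x, t) ∈ (Set.univ : Set ℝ) ×ˢ I := fun x => ⟨mem_univ x, htI⟩
  have hF1 := contDiffOn_d1_s18 hS hFsmooth
  have hF11 := contDiffOn_d1_s18 hS hF1
  have dF (x : ℝ) := hasDerivAt_d1_s18 hS hFsmooth (hmem x)
  have dF1 (x : ℝ) := hasDerivAt_d1_s18 hS hF1 (hmem x)
  have dF11 (x : ℝ) := hasDerivAt_d1_s18 hS hF11 (hmem x)
  have hDz : ∀ᶠ x in nhds z, (x, t) ∈ D :=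
    (Continuous.prodMk_left t).continuousAt.eventually (hDopen.mem_nhds hzt)
  have hDt : ∀ᶠ s in nhds t, (z, s) ∈ D :=
    (Continuous.prodMk_right z).continuousAt.eventually (hDopen.mem_nhds hzt)
  have hUr : ∀ x, (x, t) ∈ D → d1 U (F x t) t = 2 * d1 (d1 F) x t := by
    intro x hx
    have hDx : ∀ᶠ x' in nhds x, (x', t) ∈ D :=
      (Continuous.prodMk_left t).continuousAt.eventually (hDopen.mem_nhds hx)
    have h1 := (hasDerivAt_d1_s18 hOopen hUsmooth (hOmem x t hx)).comp x (dF x)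
    have h2 := ((dF1 x).pow 2).congr_of_eventuallyEq
      (hDx.mono fun x' hx' => hU x' t hx' : (fun x' => U (F x' t) t) =ᶠ[nhds x] _)
    have h := h1.unique h2
    refine mul_right_cancel₀ (hFz x t hx) (h.trans ?_)
    push_cast
    ring
  have hUrr : d1 (d1 U) (F z t) t * d1 F z t = 2 * d1 (d1 (d1 F)) z t := by
    have h1 := (hasDerivAt_d1_s18 hOopen (contDiffOn_d1_s18 hOopen hUsmooth)
      (hOmem z t hzt)).comp z (dF z)
    have h2 := ((dF11 z).const_mul 2).congr_of_eventuallyEq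
      (hDz.mono fun x' hx' => hUr x' hx' : (fun x' => d1 U (F x' t) t) =ᶠ[nhds z] _)
    exact h1.unique h2
  have hUt : d1 U (F z t) t * d2 F z t + d2 U (F z t) t = 2 * d1 F z t * d2 (d1 F) z t := by
    have h1 := hasDerivAt_comp_curve hOopen hUsmooth (hasDerivAt_d2_s18 hS hFsmooth (hmem z))
      (hasDerivAt_id t) (hOmem z t hzt)
    have h2 := ((hasDerivAt_d2_s18 hS hF1 (hmem z)).pow 2).congr_of_eventuallyEq
      (hDt.mono fun s hs => hU z s hs : (fun s => U (F z s) s) =ᶠ[nhds t] _)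
    have h := h1.unique h2
    simpa using h
  have hcont : Continuous fun x => d1 (d1 F) x t / F x t :=
    (continuous_iff_continuousAt.2 fun x => (dF11 x).continuousAt).div
      (continuous_iff_continuousAt.2 fun x => (dF x).continuousAt)
      fun x => (hFpos x t htI).ne'
  have hJ : HasDerivAt (fun x => ∫ z' in (0:ℝ)..x, d1 (d1 F) z' t / F z' t)
      (d1 (d1 F) z t / F z t) z :=
    hcont.integral_hasStrictDerivAt 0 z |>.hasDerivAt
  have hr : F z t ≠ 0 := (hFpos z t htI).ne'
  have hFtz := (((dF11 z).sub ((((dF z).inv hr).const_mul ((n:ℝ) - 2)).mul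
    (((dF1 z).pow 2).const_sub 1))).sub
    (((dF1 z).const_mul ((n:ℝ) - 1)).mul hJ)).congr_of_eventuallyEq
    (Eventually.of_forall fun x => hF x t htI : (fun x => d2 F x t) =ᶠ[nhds z] _)
  have hmix := (d1_d2_comm hS hFsmooth (hmem z)).symm.trans hFtz.deriv
  rw [hmix, hF z t htI] at hUt
  rw [hU z t hzt]
  rw [hUr z hzt] at hUt ⊢
  have hp := hFz z t hzt
  simp only [Pi.inv_apply, Pi.pow_apply] at hUt
  generalize (∫ z' in (0:ℝ)..z, d1 (d1 F) z' t / F z' t) = J at hUt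
  have hUrr' : d1 (d1 U) (F z t) t = 2 * d1 (d1 (d1 F)) z t / d1 F z t := by
    rw [eq_div_iff hp, hUrr]
  rw [hUrr', eq_sub_of_add_eq' hUt]
  field_simp
  push_cast
  ring
end
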